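/- For 1 ≤ n ≤ p, the Hilbert series of the module of covariants k[V_2]^G(V_n) satisfies the power series identity (1−t)(1−t^p) · H(k[V_2]^G(V_n), t) = 1 + t + t^2 + … + t^{n−1}; equivalently, the same identity holds for the Hilbert series of K_n = ker(Δ^n) ⊆ k[V_2]. -/

import Mathlib

open MvPolynomial

/-- The algebra automorphism `σ` of `k[V_m] = k[x_1,…,x_m]` given by
`σ x_i = x_i + x_{i+1}` for `i < m` and `σ x_m = x_m` (0-indexed). -/
noncomputable def sigmaHom (k : Type*) [CommRing k] (m : ℕ) :
    MvPolynomial (Fin m) k →ₐ[k] MvPolynomial (Fin m) k :=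
  aeval (fun i : Fin m =>
    X i + if h : (i : ℕ) + 1 < m then X (⟨(i : ℕ) + 1, h⟩ : Fin m) else 0)

/-- The twisted derivation `Δ = σ - 1` as a `k`-linear endomorphism of `k[V_m]`. -/
noncomputable def delta (k : Type*) [CommRing k] (m : ℕ) :
    Module.End k (MvPolynomial (Fin m) k) :=
  (sigmaHom k m).toLinearMap - LinearMap.id

/-- Identifying `k[V_m] ⊗ V_n` with `Fin n → k[V_m]` via the basis
`w_1, …, w_n` (0-indexed, `σ w_j = Σ_{i ≤ j} (-1)^{j-i} w_i`), this is the
diagonal action of `σ`:  `(σ·φ) i = Σ_{j ≥ i} (-1)^{j-i} σ(φ j)`.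
Covariants are its fixed points. -/
noncomputable def actL (k : Type*) [Field k] (m n : ℕ) :
    (Fin n → MvPolynomial (Fin m) k) →ₗ[k] (Fin n → MvPolynomial (Fin m) k) :=
  LinearMap.pi fun i =>
    ∑ j : Fin n,
      if (i : ℕ) ≤ (j : ℕ) then
        ((-1 : k) ^ ((j : ℕ) - (i : ℕ))) •
          ((sigmaHom k m).toLinearMap ∘ₗ LinearMap.proj j)
      else 0

/-- The product `x (x - y) ⋯ (x - (j - 1) y) y ^ m` in `k[x, y]`. -/
noncomputable def fallingMonomial (k : Type*) [CommRing k] (j m : ℕ) : MvPolynomial (Fin 2) k :=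
  (∏ l ∈ Finset.range j, (X 0 - (l : MvPolynomial (Fin 2) k) * X 1)) * X 1 ^ m

section Delta

variable {k : Type*} [CommRing k]

lemma delta_apply (m : ℕ) (f : MvPolynomial (Fin m) k) : delta k m f = sigmaHom k m f - f := rfl

lemma sigmaHom_X_zero : sigmaHom k 2 (X 0) = X 0 + X 1 := by
  simp [sigmaHom]

lemma sigmaHom_X_one : sigmaHom k 2 (X 1) = X 1 := by
  simp [sigmaHom]

lemma isHomogeneous_sigmaHom {m d : ℕ} {f : MvPolynomial (Fin m) k} (hf : f.IsHomogeneous d) :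
    (sigmaHom k m f).IsHomogeneous d := by
  have h := hf.aeval (fun i : Fin m =>
    X i + if h : (i : ℕ) + 1 < m then (X (⟨(i : ℕ) + 1, h⟩ : Fin m) : MvPolynomial (Fin m) k)
      else 0) (n := 1) fun i => by
    refine (isHomogeneous_X k i).add ?_
    split_ifs
    · exact isHomogeneous_X k _
    · exact isHomogeneous_zero _ _ _
  simpa [sigmaHom] using h

lemma isHomogeneous_delta_pow {m d : ℕ} (i : ℕ) {f : MvPolynomial (Fin m) k}
    (hf : f.IsHomogeneous d) : ((delta k m ^ i) f).IsHomogeneous d := by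
  induction i with
  | zero => simpa using hf
  | succ i ih =>
    rw [pow_succ', Module.End.mul_apply, delta_apply]
    exact (isHomogeneous_sigmaHom ih).sub ih

lemma isHomogeneous_fallingMonomial (j m : ℕ) :
    (fallingMonomial k j m).IsHomogeneous (j + m) := by
  have h1 : (∏ l ∈ Finset.range j,
      (X 0 - (l : MvPolynomial (Fin 2) k) * X 1)).IsHomogeneous (∑ _l ∈ Finset.range j, 1) := by
    refine IsHomogeneous.prod _ _ _ fun l _ => (isHomogeneous_X k 0).sub ?_
    have := (isHomogeneous_C (Fin 2) (l : k)).mul (isHomogeneous_X k (1 : Fin 2))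
    simpa using this
  have h2 := h1.mul ((isHomogeneous_X k (1 : Fin 2)).pow m)
  simpa [fallingMonomial] using h2

lemma delta_fallingMonomial_zero (m : ℕ) : delta k 2 (fallingMonomial k 0 m) = 0 := by
  simp [delta_apply, fallingMonomial, sigmaHom_X_one]

lemma delta_fallingMonomial_succ (j m : ℕ) :
    delta k 2 (fallingMonomial k (j + 1) m) =
      ((j + 1 : ℕ) : k) • fallingMonomial k j (m + 1) := by
  rw [delta_apply, fallingMonomial, map_mul, map_prod, Finset.prod_range_succ' _ j,
    Finset.prod_range_succ]
  have h : ∀ l ∈ Finset.range j,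
      sigmaHom k 2 (X 0 - ((l + 1 : ℕ) : MvPolynomial (Fin 2) k) * X 1) =
        X 0 - (l : MvPolynomial (Fin 2) k) * X 1 := fun l _ => by
    rw [map_sub, map_mul, sigmaHom_X_zero, sigmaHom_X_one, map_natCast]
    push_cast
    ring
  rw [Finset.prod_congr rfl h, MvPolynomial.smul_eq_C_mul, map_natCast, map_sub, map_mul,
    map_natCast, map_pow, sigmaHom_X_zero, sigmaHom_X_one, fallingMonomial]
  push_cast
  ring

lemma delta_pow_fallingMonomial (n : ℕ) {j d : ℕ} (hj : j ≤ d) :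
    (delta k 2 ^ n) (fallingMonomial k j (d - j)) =
      (j.descFactorial n : k) • fallingMonomial k (j - n) (d - (j - n)) := by
  induction n with
  | zero => simp
  | succ n ih =>
    rw [pow_succ', Module.End.mul_apply, ih, map_smul, Nat.descFactorial_succ]
    rcases h : j - n with _ | i
    · rw [delta_fallingMonomial_zero]
      simp
    · rw [delta_fallingMonomial_succ, smul_smul, show j - (n + 1) = i by lia,
        show d - (i + 1) + 1 = d - i by lia, Nat.cast_mul, mul_comm]

lemma X_zero_mul_fallingMonomial (j m : ℕ) :
    X 0 * fallingMonomial k j m =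
      fallingMonomial k (j + 1) m + (j : k) • fallingMonomial k j (m + 1) := by
  rw [fallingMonomial, fallingMonomial, fallingMonomial, Finset.prod_range_succ,
    MvPolynomial.smul_eq_C_mul, map_natCast]
  ring

lemma X_one_mul_fallingMonomial (j m : ℕ) :
    X 1 * fallingMonomial k j m = fallingMonomial k j (m + 1) := by
  rw [fallingMonomial, fallingMonomial]
  ring

lemma X_pow_mul_X_pow_mem_span_fallingMonomial (i m : ℕ) :
    (X 0 ^ i * X 1 ^ m : MvPolynomial (Fin 2) k) ∈
      Submodule.span k
        ((fun j => fallingMonomial k j (i + m - j)) '' Finset.range (i + m + 1)) := by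
  induction i with
  | zero =>
    refine Submodule.subset_span ⟨0, by simp, ?_⟩
    simp [fallingMonomial]
  | succ i ih =>
    rw [pow_succ', mul_assoc]
    refine Submodule.span_induction
      (p := fun f _ => X 0 * f ∈ Submodule.span k
        ((fun j => fallingMonomial k j (i + 1 + m - j)) '' Finset.range (i + 1 + m + 1)))
      ?_ ?_ ?_ ?_ ih
    · rintro _ ⟨j, hj, rfl⟩
      have hj' : j < i + m + 1 := by simpa using hj
      simp only [X_zero_mul_fallingMonomial]
      refine Submodule.add_mem _ (Submodule.subset_span ⟨j + 1, ?_, ?_⟩)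
        (Submodule.smul_mem _ _ (Submodule.subset_span ⟨j, ?_, ?_⟩))
      · simp only [Finset.coe_range, Set.mem_Iio]; lia
      · simp only; congr 1; lia
      · simp only [Finset.coe_range, Set.mem_Iio]; lia
      · simp only; congr 1; lia
    · simp
    · intro f g _ _ hf hg
      rw [mul_add]
      exact Submodule.add_mem _ hf hg
    · intro a f _ hf
      rw [mul_smul_comm]
      exact Submodule.smul_mem _ _ hf

lemma span_fallingMonomial (d : ℕ) :
    Submodule.span k ((fun j => fallingMonomial k j (d - j)) '' Finset.range (d + 1)) =
      homogeneousSubmodule (Fin 2) k d := by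
  apply le_antisymm
  · rw [Submodule.span_le]
    rintro _ ⟨j, hj, rfl⟩
    have hj' : j < d + 1 := by simpa using hj
    have h := isHomogeneous_fallingMonomial (k := k) j (d - j)
    rw [show j + (d - j) = d by lia] at h
    exact h
  · intro f hf
    rw [f.as_sum]
    refine Submodule.sum_mem _ fun e he => ?_
    have hd : e 0 + e 1 = d := by
      have := (mem_homogeneousSubmodule d f).1 hf (mem_support_iff.1 he)
      simpa [Finsupp.weight_apply, Finsupp.sum_fintype] using this
    rw [monomial_eq, ← MvPolynomial.smul_eq_C_mul, Finsupp.prod_fintype _ _ (by simp),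
      Fin.prod_univ_two, ← hd]
    exact Submodule.smul_mem _ _ (X_pow_mul_X_pow_mem_span_fallingMonomial _ _)

end Delta

section Covariants

variable {k : Type*} [Field k]

lemma linearIndependent_fallingMonomial (d : ℕ) :
    LinearIndependent k fun j => fallingMonomial k j (d - j) := by
  have hev : ∀ j, aeval ![(Polynomial.X : Polynomial k), 1] (fallingMonomial k j (d - j)) =
      ∏ l ∈ Finset.range j, (Polynomial.X - Polynomial.C (l : k)) := fun j => by
    simp [fallingMonomial, map_prod]
  have hdeg : ∀ j, (∏ l ∈ Finset.range j, (Polynomial.X - Polynomial.C (l : k))).degree =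
      ((j : ℕ) : WithBot ℕ) := fun j => by
    rw [Polynomial.degree_prod]
    simp only [Polynomial.degree_X_sub_C]
    simp
  let S : Polynomial.Sequence k :=
    ⟨fun j => ∏ l ∈ Finset.range j, (Polynomial.X - Polynomial.C (l : k)), hdeg⟩
  refine LinearIndependent.of_comp (aeval ![(Polynomial.X : Polynomial k), 1]).toLinearMap ?_
  exact (funext hev : _ ∘ _ = S) ▸ S.linearIndependent

lemma natCast_descFactorial_eq_zero_iff {p : ℕ} (hp : p.Prime) [CharP k p] (j n : ℕ) :
    (j.descFactorial n : k) = 0 ↔ j % p < n := by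
  rw [CharP.cast_eq_zero_iff k p, Nat.descFactorial_eq_prod_range,
    hp.prime.dvd_finsetProd_iff]
  constructor
  · rintro ⟨i, hi, h⟩
    rw [Finset.mem_range] at hi
    rcases le_total i j with hij | hij
    · have := (Nat.modEq_iff_dvd' hij).2 h
      exact (this.symm.trans_le (Nat.mod_le i p)).trans_lt hi
    · exact (Nat.mod_le j p).trans_lt (hij.trans_lt hi)
  · exact fun h => ⟨j % p, Finset.mem_range.2 h, Nat.dvd_sub_mod j⟩

lemma ker_delta_pow_inf_homogeneousSubmodule {p : ℕ} (hp : p.Prime) [CharP k p] (n d : ℕ) :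
    LinearMap.ker (delta k 2 ^ n) ⊓ homogeneousSubmodule (Fin 2) k d =
      Submodule.span k ((fun j => fallingMonomial k j (d - j)) ''
        ((Finset.range (d + 1)).filter fun j => j % p < n)) := by
  apply le_antisymm
  · rintro f ⟨hf, hfd⟩
    rw [SetLike.mem_coe, ← span_fallingMonomial, Submodule.mem_span_image_finset_iff_exists_fun']
      at hfd
    obtain ⟨c, rfl⟩ := hfd
    have hsum : ∑ i ∈ Finset.range (d + 1 - n),
        (c (n + i) * ((n + i).descFactorial n : k)) • fallingMonomial k i (d - i) = 0 := by
      rw [SetLike.mem_coe, LinearMap.mem_ker, map_sum] at hf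
      rw [← hf]
      have hterm : ∀ j ∈ Finset.range (d + 1),
          (delta k 2 ^ n) (c j • fallingMonomial k j (d - j)) =
            (c j * (j.descFactorial n : k)) • fallingMonomial k (j - n) (d - (j - n)) :=
        fun j hj => by
          rw [map_smul, delta_pow_fallingMonomial n (by simpa [Nat.lt_succ_iff] using hj),
            smul_smul]
      rw [Finset.sum_congr rfl hterm, Finset.range_eq_Ico, Finset.range_eq_Ico]
      rcases le_total n (d + 1) with hnd | hnd
      · have hlow : ∑ j ∈ Finset.Ico 0 n,
            (c j * (j.descFactorial n : k)) • fallingMonomial k (j - n) (d - (j - n)) = 0 :=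
          Finset.sum_eq_zero fun j hj => by
            simp [Nat.descFactorial_eq_zero_iff_lt.2 (Finset.mem_Ico.1 hj).2]
        rw [← Finset.sum_Ico_consecutive _ (Nat.zero_le n) hnd, hlow, zero_add,
          Finset.sum_Ico_eq_sum_range _ n, ← Finset.range_eq_Ico]
        simp
      · rw [Nat.sub_eq_zero_of_le hnd, Finset.Ico_self, Finset.sum_empty, Finset.sum_eq_zero]
        intro j hj
        have : j < n := by have := Finset.mem_Ico.1 hj; lia
        simp [Nat.descFactorial_eq_zero_iff_lt.2 this]
    have hc := linearIndependent_iff'.1 (linearIndependent_fallingMonomial (k := k) d) _ _ hsum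
    refine Submodule.sum_mem _ fun j hj => ?_
    by_cases h : j % p < n
    · refine Submodule.smul_mem _ _ (Submodule.subset_span ⟨j, ?_, rfl⟩)
      exact Finset.mem_coe.2 (Finset.mem_filter.2 ⟨hj, h⟩)
    · have hnj : n ≤ j := (not_lt.1 h).trans (Nat.mod_le j p)
      have h0 := hc (j - n) (by rw [Finset.mem_range] at hj ⊢; lia)
      rw [Nat.add_sub_cancel' hnj, mul_eq_zero,
        or_iff_left (mt (natCast_descFactorial_eq_zero_iff hp j n).1 h)] at h0
      simp [h0]
  · refine le_inf ?_ ?_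
    · rw [Submodule.span_le]
      rintro _ ⟨j, hj, rfl⟩
      obtain ⟨hjd, hjn⟩ := Finset.mem_filter.1 (Finset.mem_coe.1 hj)
      rw [SetLike.mem_coe, LinearMap.mem_ker,
        delta_pow_fallingMonomial n (Nat.lt_succ_iff.1 (Finset.mem_range.1 hjd)),
        (natCast_descFactorial_eq_zero_iff hp j n).2 hjn, zero_smul]
    · rw [← span_fallingMonomial]
      exact Submodule.span_mono (Set.image_mono (Finset.coe_subset.2 (Finset.filter_subset _ _)))

lemma finrank_ker_delta_pow_inf_homogeneousSubmodule {p : ℕ} (hp : p.Prime) [CharP k p]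
    (n d : ℕ) :
    Module.finrank k
        ↥(LinearMap.ker (delta k 2 ^ n) ⊓ homogeneousSubmodule (Fin 2) k d) =
      ((Finset.range (d + 1)).filter fun j => j % p < n).card := by
  classical
  have hli := linearIndependent_fallingMonomial (k := k) d
  rw [ker_delta_pow_inf_homogeneousSubmodule hp, ← Finset.coe_image,
    finrank_span_finset_eq_card, Finset.card_image_of_injective _ hli.injective]
  rw [Finset.coe_image]
  exact hli.linearIndepOn_id.mono (Set.image_subset_range _ _)

lemma actL_apply (m n : ℕ) (φ : Fin n → MvPolynomial (Fin m) k) (i : Fin n) :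
    actL k m n φ i = ∑ j : Fin n,
      if (i : ℕ) ≤ j then (-1 : k) ^ ((j : ℕ) - i) • sigmaHom k m (φ j) else 0 := by
  simp only [actL, LinearMap.pi_apply, LinearMap.sum_apply]
  refine Finset.sum_congr rfl fun j _ => ?_
  split_ifs <;> simp

lemma actL_apply_add_actL_apply_succ {m n : ℕ} (φ : Fin n → MvPolynomial (Fin m) k) (i : ℕ)
    (hi : i + 1 < n) :
    actL k m n φ ⟨i, by lia⟩ + actL k m n φ ⟨i + 1, hi⟩ = sigmaHom k m (φ ⟨i, by lia⟩) := by
  rw [actL_apply, actL_apply, ← Finset.sum_add_distrib,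
    Finset.sum_eq_single (⟨i, by lia⟩ : Fin n)]
  · simp
  · intro j _ hj
    have hj' : (j : ℕ) ≠ i := fun h => hj (Fin.ext h)
    rcases lt_or_gt_of_ne hj' with h | h
    · rw [if_neg (by simpa using h), if_neg (by simp only [not_le]; lia), add_zero]
    · rw [if_pos (by simpa using h.le), if_pos (by simpa using h), ← add_smul,
        show (j : ℕ) - i = j - (i + 1) + 1 by lia, pow_succ]
      simp
  · simp

lemma actL_apply_last {m n : ℕ} (φ : Fin (n + 1) → MvPolynomial (Fin m) k) :
    actL k m (n + 1) φ (Fin.last n) = sigmaHom k m (φ (Fin.last n)) := by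
  rw [actL_apply, Finset.sum_eq_single (Fin.last n)]
  · simp
  · intro j _ hj
    rw [if_neg]
    have := Fin.val_lt_last hj
    simpa using this
  · simp

lemma actL_eq_self_iff {m n : ℕ} (φ : Fin (n + 1) → MvPolynomial (Fin m) k) :
    actL k m (n + 1) φ = φ ↔
      (∀ (i : ℕ) (hi : i + 1 < n + 1), delta k m (φ ⟨i, by lia⟩) = φ ⟨i + 1, hi⟩) ∧
        delta k m (φ (Fin.last n)) = 0 := by
  constructor
  · intro h
    refine ⟨fun i hi => ?_, ?_⟩
    · have := actL_apply_add_actL_apply_succ φ i hi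
      rw [h] at this
      rw [delta_apply, ← this, add_sub_cancel_left]
    · have := actL_apply_last φ
      rw [h] at this
      rw [delta_apply, ← this, sub_self]
  · rintro ⟨hsucc, hlast⟩
    funext i
    induction i using Fin.reverseInduction with
    | last => rw [actL_apply_last, ← sub_eq_zero, ← hlast, delta_apply]
    | cast i ih =>
      have h1 := actL_apply_add_actL_apply_succ φ i (by lia)
      have h2 := hsucc i (by lia)
      rw [delta_apply] at h2
      change actL k m (n + 1) φ ⟨i, _⟩ = φ ⟨i, _⟩
      change actL k m (n + 1) φ ⟨i + 1, _⟩ = φ ⟨i + 1, _⟩ at ih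
      rw [ih, ← h2] at h1
      linear_combination h1

lemma map_pi_delta_pow_ker_delta_pow (m n d : ℕ) :
    (LinearMap.ker (delta k m ^ (n + 1)) ⊓ homogeneousSubmodule (Fin m) k d).map
        (LinearMap.pi fun i : Fin (n + 1) => delta k m ^ (i : ℕ)) =
      LinearMap.ker (actL k m (n + 1) - LinearMap.id) ⊓
        Submodule.pi Set.univ fun _ : Fin (n + 1) => homogeneousSubmodule (Fin m) k d := by
  ext φ
  have hker : φ ∈ LinearMap.ker (actL k m (n + 1) - LinearMap.id) ↔ actL k m (n + 1) φ = φ := by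
    rw [LinearMap.mem_ker, LinearMap.sub_apply, sub_eq_zero, LinearMap.id_apply]
  rw [Submodule.mem_inf, hker, actL_eq_self_iff]
  constructor
  · rintro ⟨f, ⟨hf, hfd⟩, rfl⟩
    refine ⟨⟨fun i hi => ?_, ?_⟩, fun i _ => isHomogeneous_delta_pow i hfd⟩
    · simp [pow_succ']
    · rw [LinearMap.pi_apply, ← Module.End.mul_apply, ← pow_succ']
      exact hf
  · rintro ⟨⟨hsucc, hlast⟩, hφd⟩
    have hφ : ∀ (i : ℕ) (hi : i < n + 1), (delta k m ^ i) (φ 0) = φ ⟨i, hi⟩ := by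
      intro i
      induction i with
      | zero => simp
      | succ i ih =>
        intro hi
        rw [pow_succ', Module.End.mul_apply, ih (by lia), hsucc i hi]
    refine ⟨φ 0, ⟨?_, hφd 0 trivial⟩, ?_⟩
    · rw [SetLike.mem_coe, LinearMap.mem_ker, pow_succ', Module.End.mul_apply,
        hφ n (Nat.lt_succ_self n)]
      exact hlast
    · funext i
      exact hφ i i.2

lemma finrank_ker_actL_sub_id (m d : ℕ) {n : ℕ} (hn : 1 ≤ n) :
    Module.finrank k ↥(LinearMap.ker (actL k m n - LinearMap.id) ⊓
        Submodule.pi Set.univ fun _ : Fin n => homogeneousSubmodule (Fin m) k d) =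
      Module.finrank k
        ↥(LinearMap.ker (delta k m ^ n) ⊓ homogeneousSubmodule (Fin m) k d) := by
  obtain ⟨n, rfl⟩ := Nat.exists_eq_add_of_le' hn
  have hinj : Function.Injective
      (LinearMap.pi fun i : Fin (n + 1) => delta k m ^ (i : ℕ)) := fun f g h => by
    simpa using congrFun h 0
  rw [← map_pi_delta_pow_ker_delta_pow]
  exact (Submodule.equivMapOfInjective _ hinj _).finrank_eq.symm

end Covariants

lemma one_sub_X_mul_one_sub_X_pow_mul_mk_card {p n : ℕ} (hnp : n ≤ p) :
    (1 - PowerSeries.X) * (1 - PowerSeries.X ^ p) *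
        PowerSeries.mk (fun d =>
          (((Finset.range (d + 1)).filter fun j => j % p < n).card : ℤ)) =
      ∑ i ∈ Finset.range n, (PowerSeries.X : PowerSeries ℤ) ^ i := by
  have h1 : (1 - PowerSeries.X) * PowerSeries.mk (fun d =>
        (((Finset.range (d + 1)).filter fun j => j % p < n).card : ℤ)) =
      PowerSeries.mk fun d => if d % p < n then 1 else 0 := by
    ext d
    rw [sub_mul, one_mul, map_sub, PowerSeries.coeff_mk, PowerSeries.coeff_mk]
    rcases d with _ | d
    · rw [PowerSeries.coeff_zero_X_mul, Finset.card_filter, Finset.sum_range_one]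
      push_cast
      simp
    · rw [PowerSeries.coeff_succ_X_mul, PowerSeries.coeff_mk, Finset.card_filter,
        Finset.card_filter, Finset.sum_range_succ _ (d + 1)]
      push_cast
      ring
  rw [mul_comm (1 - PowerSeries.X), mul_assoc, h1]
  ext d
  rw [sub_mul, one_mul, map_sub, PowerSeries.coeff_mk, PowerSeries.coeff_X_pow_mul', map_sum]
  simp only [PowerSeries.coeff_X_pow, PowerSeries.coeff_mk, Finset.sum_ite_eq, Finset.mem_range]
  by_cases hd : p ≤ d
  · rw [if_pos hd, ← Nat.mod_eq_sub_mod hd, sub_self, if_neg (by lia)]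
  · rw [if_neg hd, Nat.mod_eq_of_lt (not_le.1 hd), sub_zero]

/-- For `1 ≤ n ≤ p`, the Hilbert series of the module of covariants
`k[V_2]^G(V_n)` satisfies `(1−t)(1−t^p)·H = 1 + t + … + t^{n−1}`;
equivalently the same holds for `H(K_n,t)` where `K_n = ker(Δ^n)`. -/
theorem statement12 (p : ℕ) (hp : p.Prime) (k : Type*) [Field k] [CharP k p]
    (n : ℕ) (hn : 1 ≤ n) (hnp : n ≤ p) :
    ((1 - PowerSeries.X) * (1 - PowerSeries.X ^ p) *
      PowerSeries.mk (fun d =>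
        (Module.finrank k
          ↥(LinearMap.ker (actL k 2 n - LinearMap.id) ⊓
            Submodule.pi Set.univ fun _ : Fin n => homogeneousSubmodule (Fin 2) k d) : ℤ)) =
      ∑ i ∈ Finset.range n, PowerSeries.X ^ i) ∧
    ((1 - PowerSeries.X) * (1 - PowerSeries.X ^ p) *
      PowerSeries.mk (fun d =>
        (Module.finrank k
          ↥(LinearMap.ker (delta k 2 ^ n) ⊓ homogeneousSubmodule (Fin 2) k d) : ℤ)) =
      ∑ i ∈ Finset.range n, (PowerSeries.X : PowerSeries ℤ) ^ i) := by
  have hdim := finrank_ker_delta_pow_inf_homogeneousSubmodule (k := k) hp n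
  refine ⟨?_, ?_⟩
  · simp only [finrank_ker_actL_sub_id 2 _ hn, hdim]
    exact one_sub_X_mul_one_sub_X_pow_mul_mk_card hnp
  · simp only [hdim]
    exact one_sub_X_mul_one_sub_X_pow_mul_mk_card hnp
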